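/- Let m be a positive integer and let a ∈ L. If for every nonzero prime ideal p of O_L the equation x^m = a has a solution x in the p-adic completion L_p, then the equation x^m = a has a solution x in L. -/

import Mathlib

set_option synthInstance.maxHeartbeats 1000000
set_option maxHeartbeats 2000000

open IntermediateField Polynomial NumberField IsDedekindDomain HeightOneSpectrum

/-- The real fourth root of `2`. -/
noncomputable def alpha : ℝ := (2 : ℝ) ^ ((1 : ℝ) / 4)

lemma alpha_pow4 : alpha ^ 4 = 2 := by
  unfold alpha
  rw [← Real.rpow_natCast ((2:ℝ) ^ ((1:ℝ)/4)) 4, ← Real.rpow_mul (by norm_num)]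
  norm_num

/-- The number field `L = ℚ(2^{1/4})`, as a subfield of `ℝ`. -/
noncomputable def L : IntermediateField ℚ ℝ := ℚ⟮alpha⟯

lemma alpha_int : IsIntegral ℚ alpha :=
  ⟨X ^ 4 - C 2, monic_X_pow_sub_C _ (by norm_num), by simp [alpha_pow4]⟩

instance : NumberField L := by
  haveI : FiniteDimensional ℚ L := IntermediateField.adjoin.finiteDimensional alpha_int
  exact ⟨⟩

noncomputable instance (v : HeightOneSpectrum (𝓞 L)) : Algebra L (v.adicCompletion L) :=
  instAlgebraAdicCompletion (𝓞 L) L v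

open Filter Topology in
/-- weight of an ideal -/
noncomputable def wt {K : Type*} [Field K] [NumberField K] (s : ℝ) (I : Ideal (𝓞 K)) : ENNReal :=
  ENNReal.ofReal ((Ideal.absNorm I : ℝ) ^ (-s))

lemma wt_mul {K : Type*} [Field K] [NumberField K] (s : ℝ) (I J : Ideal (𝓞 K)) :
    wt s (I * J) = wt s I * wt s J := by
  unfold wt
  rw [map_mul, Nat.cast_mul, Real.mul_rpow (by positivity) (by positivity),
    ENNReal.ofReal_mul (by positivity)]

lemma tsum_wt_eq (K : Type*) [Field K] [NumberField K] (s : ℝ) (hs : 1 < s)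
    (hne : dedekindZeta K s ≠ 0) :
    ∑' I : Ideal (𝓞 K), wt s I = ENNReal.ofReal (dedekindZeta K s).re := by
  set c : ℕ → ℕ := fun n => Nat.card {I : Ideal (𝓞 K) // Ideal.absNorm I = n} with hc
  have hterm : ∀ n : ℕ, LSeries.term (fun n => ((c n : ℕ) : ℂ)) s n
      = (((c n : ℝ) * (n : ℝ) ^ (-s) : ℝ) : ℂ) := by
    intro n
    rw [LSeries.term_def]
    split_ifs with h
    · subst h
      rw [Nat.cast_zero, Real.zero_rpow (by linarith)]; simp
    · rw [Real.rpow_neg (by positivity)]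
      push_cast
      rw [Complex.ofReal_cpow (by positivity)]
      simp [div_eq_mul_inv]
  have hz : dedekindZeta K s = ∑' n : ℕ, (((c n : ℝ) * (n : ℝ) ^ (-s) : ℝ) : ℂ) := by
    unfold dedekindZeta LSeries
    exact tsum_congr hterm
  have hsum : Summable (fun n : ℕ => (c n : ℝ) * (n : ℝ) ^ (-s)) := by
    by_contra hcon
    apply hne
    rw [hz]
    apply tsum_eq_zero_of_not_summable
    intro h
    exact hcon (Complex.summable_ofReal.mp h)
  rw [hz, ← Complex.ofReal_tsum, Complex.ofReal_re,
    ENNReal.ofReal_tsum_of_nonneg (fun n => by positivity) hsum,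
    ← ENNReal.tsum_fiberwise _ (fun I : Ideal (𝓞 K) => Ideal.absNorm I)]
  refine tsum_congr fun n => ?_
  have hfin : Finite {I : Ideal (𝓞 K) // Ideal.absNorm I = n} :=
    (Ideal.finite_setOfPred_absNorm_eq (S := 𝓞 K) n).to_subtype
  have h1 : ∀ b : ((fun I : Ideal (𝓞 K) => Ideal.absNorm I) ⁻¹' {n}),
      wt s (b : Ideal (𝓞 K)) = ENNReal.ofReal ((n : ℝ) ^ (-s)) := by
    rintro ⟨b, hb⟩
    have hb' : Ideal.absNorm b = n := hb
    simp [wt, hb']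
  have hfin' : Finite ((fun I : Ideal (𝓞 K) => Ideal.absNorm I) ⁻¹' {n}) := hfin
  have hft := Fintype.ofFinite ((fun I : Ideal (𝓞 K) => Ideal.absNorm I) ⁻¹' {n})
  rw [tsum_congr h1, tsum_fintype, Finset.sum_const, nsmul_eq_mul,
    ENNReal.ofReal_mul (by positivity), ENNReal.ofReal_natCast]
  congr 2
  rw [Finset.card_univ, ← Nat.card_eq_fintype_card]
  rfl

open Filter Topology in
lemma tendsto_wt (K : Type*) [Field K] [NumberField K] :
    Tendsto (fun s : ℝ => ENNReal.ofReal (s - 1) * ∑' I : Ideal (𝓞 K), wt s I) (𝓝[>] 1)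
      (𝓝 (ENNReal.ofReal (dedekindZeta_residue K))) := by
  have h := tendsto_sub_one_mul_dedekindZeta_nhdsGT K
  have hre := (Complex.continuous_re.tendsto _).comp h
  have hre2 := ENNReal.tendsto_ofReal hre
  have hne : ∀ᶠ s : ℝ in 𝓝[>] 1, ((s : ℂ) - 1) * dedekindZeta K s ≠ 0 :=
    h.eventually_ne (by exact_mod_cast dedekindZeta_residue_ne_zero K)
  rw [Complex.ofReal_re] at hre2
  refine hre2.congr' ?_
  filter_upwards [hne, self_mem_nhdsWithin] with s hs hs1
  have hs1' : 1 < s := hs1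
  rw [tsum_wt_eq K s hs1' (right_ne_zero_of_mul hs), ← ENNReal.ofReal_mul (by linarith)]
  congr 1
  simp only [Function.comp]
  rw [show ((s : ℂ) - 1) = ((s - 1 : ℝ) : ℂ) by push_cast; rfl, Complex.re_ofReal_mul]

/-- nonzero ideals prime to a finite set -/
def avoid {K : Type*} [Field K] (S : Finset (Ideal (𝓞 K))) : Set (Ideal (𝓞 K)) :=
  {I | I ≠ ⊥ ∧ ∀ P ∈ S, ¬ P ∣ I}

lemma wt_le_half {K : Type*} [Field K] [NumberField K] (s : ℝ) (hs : 1 < s) (P : Ideal (𝓞 K))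
    (hP : P.IsPrime) : wt s P ≤ 2⁻¹ := by
  unfold wt
  by_cases h0 : P = ⊥
  · subst h0
    simp [Real.zero_rpow (show -s ≠ 0 by linarith)]
  have h2 : 2 ≤ Ideal.absNorm P := by
    have h1 : Ideal.absNorm P ≠ 1 := by
      rw [Ne, Ideal.absNorm_eq_one_iff]; exact hP.ne_top
    have h0' : Ideal.absNorm P ≠ 0 := by
      rw [Ne, Ideal.absNorm_eq_zero_iff]; exact h0
    omega
  have h2' : (2 : ℝ) ≤ Ideal.absNorm P := by exact_mod_cast h2
  have : ((Ideal.absNorm P : ℝ) ^ (-s)) ≤ 2⁻¹ := by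
    calc ((Ideal.absNorm P : ℝ) ^ (-s)) ≤ (Ideal.absNorm P : ℝ) ^ (-1 : ℝ) :=
          Real.rpow_le_rpow_of_exponent_le (by linarith) (by linarith)
      _ = (Ideal.absNorm P : ℝ)⁻¹ := by rw [Real.rpow_neg_one]
      _ ≤ 2⁻¹ := by gcongr
  calc ENNReal.ofReal ((Ideal.absNorm P : ℝ) ^ (-s)) ≤ ENNReal.ofReal 2⁻¹ :=
        ENNReal.ofReal_le_ofReal this
    _ = 2⁻¹ := by rw [ENNReal.ofReal_inv_of_pos (by norm_num)]; simp

lemma avoid_bound {K : Type*} [Field K] [NumberField K] (s : ℝ) (hs : 1 < s)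
    (hfin : ∑' I : Ideal (𝓞 K), wt s I ≠ ⊤) (S : Finset (Ideal (𝓞 K)))
    (hS : ∀ P ∈ S, P.IsPrime) :
    ∑' I : Ideal (𝓞 K), wt s I ≤ 2 ^ S.card * ∑' I : avoid S, wt s (I : Ideal (𝓞 K)) := by
  classical
  induction S using Finset.induction_on with
  | empty =>
    simp only [Finset.card_empty, pow_zero, one_mul]
    have h1 : ∑' I : Ideal (𝓞 K), wt s I
        = ∑' I : (Set.univ : Set (Ideal (𝓞 K))), wt s (I : Ideal (𝓞 K)) := by
      rw [tsum_univ (fun I : Ideal (𝓞 K) => wt s I)]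
    have h2 : (Set.univ : Set (Ideal (𝓞 K))) = {⊥} ∪ avoid ∅ := by
      ext I; simp [avoid]; tauto
    rw [h1, h2]
    refine (ENNReal.tsum_union_le _ _ _).trans ?_
    have : ∑' x : ({⊥} : Set (Ideal (𝓞 K))), wt s (x : Ideal (𝓞 K)) = 0 := by
      simp [wt, Real.zero_rpow (show -s ≠ 0 by linarith)]
    rw [this, zero_add]
  | insert P S hPS ih =>
    have hP := hS P (Finset.mem_insert_self _ _)
    have ih' := ih (fun Q hQ => hS Q (Finset.mem_insert_of_mem hQ))
    set A := ∑' I : avoid S, wt s (I : Ideal (𝓞 K)) with hA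
    set B := ∑' I : avoid (insert P S), wt s (I : Ideal (𝓞 K)) with hB
    have hAfin : A ≠ ⊤ := by
      refine ne_top_of_le_ne_top hfin ?_
      exact ENNReal.tsum_comp_le_tsum_of_injective (Subtype.val_injective) (fun I => wt s I)
    have hAB : A ≤ B + 2⁻¹ * A := by
      have hsub : avoid S ⊆ avoid (insert P S) ∪ ((fun J => P * J) '' avoid S) := by
        rintro I ⟨hI0, hI⟩
        by_cases hPI : P ∣ I
        · right
          obtain ⟨J, rfl⟩ := hPI
          refine ⟨J, ⟨?_, ?_⟩, rfl⟩
          · rintro rfl; simp at hI0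
          · intro Q hQ hQJ
            exact hI Q hQ (hQJ.mul_left _)
        · left
          refine ⟨hI0, ?_⟩
          intro Q hQ
          rcases Finset.mem_insert.mp hQ with rfl | hQ
          · exact hPI
          · exact hI Q hQ
      refine (ENNReal.tsum_mono_subtype (fun I => wt s I) hsub).trans ?_
      refine (ENNReal.tsum_union_le _ _ _).trans ?_
      gcongr
      have hsurj : Function.Surjective (fun J : avoid S =>
          (⟨P * J, ⟨J, J.2, rfl⟩⟩ : ((fun J => P * J) '' avoid S))) := by
        rintro ⟨_, J, hJ, rfl⟩
        exact ⟨⟨J, hJ⟩, rfl⟩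
      refine (ENNReal.tsum_le_tsum_comp_of_surjective hsurj _).trans ?_
      rw [hA, ← ENNReal.tsum_mul_left]
      refine ENNReal.tsum_le_tsum fun J => ?_
      simp only [wt_mul]
      gcongr
      exact wt_le_half s hs P hP
    have hA2 : A ≤ 2 * B := by
      have h3 : 2⁻¹ * A + 2⁻¹ * A = A := by
        rw [← add_mul, ENNReal.inv_two_add_inv_two, one_mul]
      have h4 : 2⁻¹ * A ≤ B := by
        have hne : 2⁻¹ * A ≠ ⊤ := ENNReal.mul_ne_top (by simp) hAfin
        nth_rewrite 1 [← h3] at hAB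
        exact (ENNReal.add_le_add_iff_right hne).mp hAB
      calc A = 2 * (2⁻¹ * A) := by
            rw [← mul_assoc, ENNReal.mul_inv_cancel (by simp) (by simp), one_mul]
        _ ≤ 2 * B := by gcongr
    rw [Finset.card_insert_of_notMem hPS, pow_succ, mul_assoc]
    exact ih'.trans (by gcongr)

open UniqueFactorizationMonoid in
lemma wt_map_prod {F K : Type*} [Field F] [NumberField F] [Field K] [NumberField K] (s : ℝ)
    (q : Ideal (𝓞 F) → Ideal (𝓞 K)) (m : Multiset (Ideal (𝓞 F)))
    (h : ∀ P ∈ m, Ideal.absNorm (q P) = Ideal.absNorm P) :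
    wt s (m.map q).prod = wt s m.prod := by
  unfold wt
  congr 3
  rw [map_multiset_prod, map_multiset_prod, Multiset.map_map]
  congr 1
  exact Multiset.map_congr rfl h

open UniqueFactorizationMonoid in
lemma zeta_sq_le {F K : Type*} [Field F] [NumberField F] [Field K] [NumberField K] (s : ℝ)
    (S : Finset (Ideal (𝓞 F))) (q₁ q₂ : Ideal (𝓞 F) → Ideal (𝓞 K))
    (c : Ideal (𝓞 K) → Ideal (𝓞 F))
    (h₁ : ∀ P : Ideal (𝓞 F), Prime P → P ∉ S → Prime (q₁ P) ∧ c (q₁ P) = P ∧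
      Ideal.absNorm (q₁ P) = Ideal.absNorm P)
    (h₂ : ∀ P : Ideal (𝓞 F), Prime P → P ∉ S → Prime (q₂ P) ∧ c (q₂ P) = P ∧
      Ideal.absNorm (q₂ P) = Ideal.absNorm P)
    (hne : ∀ P : Ideal (𝓞 F), Prime P → P ∉ S → q₁ P ≠ q₂ P) :
    (∑' I : avoid S, wt s (I : Ideal (𝓞 F))) * (∑' I : avoid S, wt s (I : Ideal (𝓞 F)))
      ≤ ∑' I : Ideal (𝓞 K), wt s I := by
  classical
  have hmem : ∀ I : avoid S, ∀ P ∈ normalizedFactors (I : Ideal (𝓞 F)), Prime P ∧ P ∉ S := by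
    rintro ⟨I, hI0, hI⟩ P hP
    refine ⟨prime_of_normalized_factor P hP, fun hPS => hI P hPS (dvd_of_mem_normalizedFactors hP)⟩
  let φ : (q : Ideal (𝓞 F) → Ideal (𝓞 K)) → avoid S → Multiset (Ideal (𝓞 K)) :=
    fun q I => (normalizedFactors (I : Ideal (𝓞 F))).map q
  let f : avoid S × avoid S → Ideal (𝓞 K) := fun p => (φ q₁ p.1 + φ q₂ p.2).prod
  have hf : ∀ p, normalizedFactors (f p) = φ q₁ p.1 + φ q₂ p.2 := by
    intro p
    apply normalizedFactors_prod_of_prime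
    intro Q hQ
    rcases Multiset.mem_add.mp hQ with hQ | hQ
    · obtain ⟨P, hP, rfl⟩ := Multiset.mem_map.mp hQ
      exact (h₁ P (hmem _ P hP).1 (hmem _ P hP).2).1
    · obtain ⟨P, hP, rfl⟩ := Multiset.mem_map.mp hQ
      exact (h₂ P (hmem _ P hP).1 (hmem _ P hP).2).1
  have hrec : ∀ (q : Ideal (𝓞 F) → Ideal (𝓞 K)) (I : avoid S),
      (∀ P : Ideal (𝓞 F), Prime P → P ∉ S → c (q P) = P) →
      ((φ q I).map c).prod = I := by
    intro q I hq
    simp only [φ, Multiset.map_map]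
    rw [Multiset.map_congr rfl (g := id)]
    · rw [Multiset.map_id, Ideal.prod_normalizedFactors_eq_self I.2.1]
    · intro P hP
      exact hq P (hmem _ P hP).1 (hmem _ P hP).2
  have hfil1 : ∀ p : avoid S × avoid S,
      (normalizedFactors (f p)).filter (fun Q => q₁ (c Q) = Q) = φ q₁ p.1 := by
    intro p
    rw [hf, Multiset.filter_add, Multiset.filter_eq_self.mpr, Multiset.filter_eq_nil.mpr, add_zero]
    · intro Q hQ
      obtain ⟨P, hP, rfl⟩ := Multiset.mem_map.mp hQ
      rw [(h₂ P (hmem _ P hP).1 (hmem _ P hP).2).2.1]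
      exact hne P (hmem _ P hP).1 (hmem _ P hP).2
    · intro Q hQ
      obtain ⟨P, hP, rfl⟩ := Multiset.mem_map.mp hQ
      rw [(h₁ P (hmem _ P hP).1 (hmem _ P hP).2).2.1]
  have hinj : Function.Injective f := by
    intro p p' hpp
    have e1 : φ q₁ p.1 = φ q₁ p'.1 := by rw [← hfil1, ← hfil1, hpp]
    have e2 : φ q₂ p.2 = φ q₂ p'.2 := by
      have := hf p
      rw [hpp, hf p', e1] at this
      exact (add_left_cancel this).symm
    refine Prod.ext (Subtype.ext ?_) (Subtype.ext ?_)
    · rw [← hrec q₁ p.1 (fun P a b => (h₁ P a b).2.1), e1,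
        hrec q₁ p'.1 (fun P a b => (h₁ P a b).2.1)]
    · rw [← hrec q₂ p.2 (fun P a b => (h₂ P a b).2.1), e2,
        hrec q₂ p'.2 (fun P a b => (h₂ P a b).2.1)]
  have hwt : ∀ p, wt s (f p) = wt s (p.1 : Ideal (𝓞 F)) * wt s (p.2 : Ideal (𝓞 F)) := by
    intro p
    simp only [f, φ, Multiset.prod_add, wt_mul]
    rw [wt_map_prod s q₁ _ (fun P hP => (h₁ P (hmem _ P hP).1 (hmem _ P hP).2).2.2),
      wt_map_prod s q₂ _ (fun P hP => (h₂ P (hmem _ P hP).1 (hmem _ P hP).2).2.2),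
      Ideal.prod_normalizedFactors_eq_self p.1.2.1, Ideal.prod_normalizedFactors_eq_self p.2.2.1]
  calc _ = ∑' p : avoid S × avoid S, wt s (p.1 : Ideal (𝓞 F)) * wt s (p.2 : Ideal (𝓞 F)) := by
        rw [ENNReal.tsum_prod (f := fun a b : avoid S =>
          wt s (a : Ideal (𝓞 F)) * wt s (b : Ideal (𝓞 F)))]
        simp_rw [ENNReal.tsum_mul_left, ENNReal.tsum_mul_right]
    _ = ∑' p : avoid S × avoid S, wt s (f p) := tsum_congr fun p => (hwt p).symm
    _ ≤ _ := ENNReal.tsum_comp_le_tsum_of_injective hinj _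

open Filter Topology in
lemma no_double {F K : Type*} [Field F] [NumberField F] [Field K] [NumberField K]
    (S : Finset (Ideal (𝓞 F))) (q₁ q₂ : Ideal (𝓞 F) → Ideal (𝓞 K))
    (hS : ∀ P ∈ S, P.IsPrime)
    (c : Ideal (𝓞 K) → Ideal (𝓞 F))
    (h₁ : ∀ P : Ideal (𝓞 F), Prime P → P ∉ S → Prime (q₁ P) ∧ c (q₁ P) = P ∧
      Ideal.absNorm (q₁ P) = Ideal.absNorm P)
    (h₂ : ∀ P : Ideal (𝓞 F), Prime P → P ∉ S → Prime (q₂ P) ∧ c (q₂ P) = P ∧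
      Ideal.absNorm (q₂ P) = Ideal.absNorm P)
    (hne : ∀ P : Ideal (𝓞 F), Prime P → P ∉ S → q₁ P ≠ q₂ P) : False := by
  have hF := tendsto_wt F
  have hK := tendsto_wt K
  have h0 : Tendsto (fun s : ℝ => ENNReal.ofReal (s - 1)) (𝓝[>] 1) (𝓝 0) := by
    have : Tendsto (fun s : ℝ => s - 1) (𝓝[>] 1) (𝓝 0) := by
      have : Tendsto (fun s : ℝ => s - 1) (𝓝 1) (𝓝 (1 - 1)) := tendsto_id.sub_const 1
      rw [sub_self] at this
      exact this.mono_left nhdsWithin_le_nhds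
    simpa using ENNReal.tendsto_ofReal this
  have hFF := ENNReal.Tendsto.mul hF (Or.inr ENNReal.ofReal_ne_top) hF (Or.inr ENNReal.ofReal_ne_top)
  have hKK := ENNReal.Tendsto.mul (ENNReal.Tendsto.const_mul (a := (2 ^ S.card * 2 ^ S.card : ENNReal))
    h0 (Or.inr (by finiteness))) (Or.inr ENNReal.ofReal_ne_top) hK (Or.inr (by simp))
  have hpos := dedekindZeta_residue_pos F
  have hle := le_of_tendsto_of_tendsto hFF hKK (by
    have hfin : ∀ᶠ s : ℝ in 𝓝[>] 1,
        ENNReal.ofReal (s - 1) * ∑' I : Ideal (𝓞 F), wt s I < ⊤ :=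
      hF.eventually (gt_mem_nhds ENNReal.ofReal_lt_top)
    filter_upwards [hfin, self_mem_nhdsWithin] with s hs hs1
    have hs1' : 1 < s := hs1
    have hfin' : ∑' I : Ideal (𝓞 F), wt s I ≠ ⊤ := by
      intro h
      rw [h, ENNReal.mul_top] at hs
      · exact lt_irrefl _ hs
      · simpa using hs1'
    have hb := avoid_bound s hs1' hfin' S hS
    have hz := zeta_sq_le s S q₁ q₂ c h₁ h₂ hne
    calc _ ≤ (ENNReal.ofReal (s - 1) * (2 ^ S.card * ∑' I : avoid S, wt s (I : Ideal (𝓞 F)))) *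
          (ENNReal.ofReal (s - 1) * (2 ^ S.card * ∑' I : avoid S, wt s (I : Ideal (𝓞 F)))) := by
          gcongr
      _ = (2 ^ S.card * 2 ^ S.card * ENNReal.ofReal (s - 1)) * (ENNReal.ofReal (s - 1) *
          ((∑' I : avoid S, wt s (I : Ideal (𝓞 F))) *
            (∑' I : avoid S, wt s (I : Ideal (𝓞 F))))) := by ring
      _ ≤ _ := by gcongr)
  simp only [mul_zero, zero_mul, nonpos_iff_eq_zero, mul_eq_zero, or_self,
    ENNReal.ofReal_eq_zero] at hle
  linarith

open Pointwise in
lemma kummer_split {F K : Type*} [Field F] [NumberField F] [Field K] [NumberField K]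
    [Algebra F K] [IsGalois F K] (n : ℕ) (hn : 0 < n) (ζ : F) (hζ : IsPrimitiveRoot ζ n)
    (a : 𝓞 F) (β : 𝓞 K) (hβ : β ^ n = algebraMap (𝓞 F) (𝓞 K) a)
    (hgen : ∀ σ : Gal(K/F), σ • β = β → σ = 1)
    (P : Ideal (𝓞 F)) (hP : P.IsPrime) (hPn : (n : 𝓞 F) ∉ P) (hPa : a ∉ P)
    (hx : ∃ x : 𝓞 F, x ^ n - a ∈ P) (Q : Ideal (𝓞 K)) (hQ : Q.IsPrime) (hQP : Q.LiesOver P) :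
    (∀ σ : Gal(K/F), σ • Q = Q → σ = 1) ∧ Ideal.absNorm Q = Ideal.absNorm P := by
  have : NeZero n := ⟨hn.ne'⟩
  have hover : ∀ y : 𝓞 F, algebraMap (𝓞 F) (𝓞 K) y ∈ Q ↔ y ∈ P := fun y =>
    (Ideal.mem_of_liesOver Q P y).symm
  have hroots : ∀ ξ : K, ξ ^ n = 1 → ∃ η : F, η ^ n = 1 ∧ algebraMap F K η = ξ := by
    intro ξ hξ
    have hζK : IsPrimitiveRoot (algebraMap F K ζ) n :=
      hζ.map_of_injective (algebraMap F K).injective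
    obtain ⟨i, -, hi⟩ := hζK.eq_pow_of_pow_eq_one hξ
    refine ⟨ζ ^ i, ?_, by rw [map_pow, hi]⟩
    rw [← pow_mul, mul_comm, pow_mul, hζ.pow_eq_one, one_pow]
  have hfix : ∀ (σ : Gal(K/F)) (ξ : 𝓞 K), ξ ^ n = 1 → σ • ξ = ξ := by
    intro σ ξ hξ
    obtain ⟨η, -, hη⟩ := hroots (ξ : K) (by rw [← map_pow, hξ, map_one])
    apply RingOfIntegers.coe_injective
    change σ (ξ : K) = ξ
    rw [← hη, σ.commutes]
  have hβ0 : β ≠ 0 := by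
    rintro rfl
    rw [zero_pow hn.ne'] at hβ
    apply hPa
    rw [← hover, ← hβ]; exact Q.zero_mem
  have hβQ : β ∉ Q := by
    intro h
    apply hPa
    rw [← hover, ← hβ]
    exact Ideal.pow_mem_of_mem Q h n hn
  have hfixF : ∀ (σ : Gal(K/F)) (y : 𝓞 F),
      σ • (algebraMap (𝓞 F) (𝓞 K) y) = algebraMap (𝓞 F) (𝓞 K) y := by
    intro σ y
    exact smul_algebraMap σ y
  have hstab : ∀ σ : Gal(K/F), σ • Q = Q → σ = 1 := by
    intro σ hσ
    apply hgen
    obtain ⟨x, hx⟩ := hx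
    have hζK : IsPrimitiveRoot (algebraMap F K ζ) n :=
      hζ.map_of_injective (algebraMap F K).injective
    have hζi : IsPrimitiveRoot (hζK.toInteger) n := hζK.toInteger_isPrimitiveRoot
    have hprod := hζi.pow_sub_pow_eq_prod_sub_mul β (algebraMap (𝓞 F) (𝓞 K) x) hn
    have hmemQ : β ^ n - (algebraMap (𝓞 F) (𝓞 K) x) ^ n ∈ Q := by
      rw [hβ, ← map_pow, ← map_sub, hover, ← neg_sub]
      exact neg_mem hx
    rw [hprod, hQ.prod_mem_iff] at hmemQ
    obtain ⟨ξ, hξ, hmem⟩ := hmemQ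
    have hξ1 : ξ ^ n = 1 := (Polynomial.mem_nthRootsFinset hn _).mp hξ
    have hmem2 : σ • β - ξ * algebraMap (𝓞 F) (𝓞 K) x ∈ Q := by
      have := Ideal.smul_mem_pointwise_smul σ _ Q hmem
      rw [hσ, smul_sub, smul_mul', hfix σ ξ hξ1, hfixF] at this
      exact this
    have hmem3 : σ • β - β ∈ Q := by
      have := Q.sub_mem hmem2 hmem
      rwa [sub_sub_sub_cancel_right] at this
    have hσβ : (σ • β) ^ n = β ^ n := by
      rw [← smul_pow', hβ, hfixF]
    have hβK : (β : K) ≠ 0 := by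
      intro h; exact hβ0 (RingOfIntegers.ext h)
    have hη1 : (((σ • β : 𝓞 K) : K) / (β : K)) ^ n = 1 := by
      rw [div_pow, ← map_pow, ← map_pow, hσβ, div_self]
      rw [map_pow]; exact pow_ne_zero n hβK
    have hηint : IsIntegral ℤ (((σ • β : 𝓞 K) : K) / (β : K)) :=
      ⟨X ^ n - 1, monic_X_pow_sub_C 1 hn.ne', by simp [hη1]⟩
    obtain ⟨η, hη⟩ : ∃ η : 𝓞 K, algebraMap (𝓞 K) K η =
        algebraMap (𝓞 K) K (σ • β) / algebraMap (𝓞 K) K β := ⟨⟨_, hηint⟩, rfl⟩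
    have hηn : η ^ n = 1 := by
      apply RingOfIntegers.coe_injective
      rw [map_pow, hη, map_one]; exact hη1
    have hηβ : σ • β = η * β := by
      apply RingOfIntegers.coe_injective
      rw [map_mul, hη]; exact (div_mul_cancel₀ _ hβK).symm
    by_cases hη' : η = 1
    · rw [hηβ, hη', one_mul]
    · exfalso
      have hdvd := sub_one_dvd_natCast_of_pow_eq_one hηn hη'
      have : (η - 1) * β ∈ Q := by
        rw [sub_mul, one_mul, ← hηβ]; exact hmem3
      rcases hQ.mem_or_mem this with h | h
      · apply hPn
        rw [← hover, map_natCast]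
        exact Q.mem_of_dvd hdvd h
      · exact hβQ h
  refine ⟨hstab, ?_⟩
  have hmain := Ideal.ncard_primesOver_mul_ramificationIdxIn_mul_inertiaDegIn P (𝓞 K) Gal(K/F)
  have hcard0 : Nat.card Gal(K/F) ≠ 0 := Nat.card_pos.ne'
  have hnc0 : (P.primesOver (𝓞 K)).ncard ≠ 0 := by
    intro h; rw [h, zero_mul] at hmain; exact hcard0 hmain.symm
  have hfinP : (P.primesOver (𝓞 K)).Finite := Set.finite_of_ncard_ne_zero hnc0
  have hle : Nat.card Gal(K/F) ≤ (P.primesOver (𝓞 K)).ncard := by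
    have : Finite (P.primesOver (𝓞 K)) := hfinP
    rw [← Nat.card_coe_set_eq]
    refine Nat.card_le_card_of_injective
      (fun σ : Gal(K/F) => (⟨σ • Q, ⟨inferInstance, inferInstance⟩⟩ : P.primesOver (𝓞 K))) ?_
    intro σ τ hστ
    have h1 : σ • Q = τ • Q := congrArg Subtype.val hστ
    have h2 : (τ⁻¹ * σ) • Q = Q := by rw [mul_smul, h1, inv_smul_smul]
    have h3 := hstab _ h2
    rw [inv_mul_eq_one] at h3
    exact h3.symm
  have hf1 : P.inertiaDegIn (𝓞 K) = 1 := by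
    have h4 : P.ramificationIdxIn (𝓞 K) * P.inertiaDegIn (𝓞 K) ≤ 1 := by
      by_contra hcon
      push Not at hcon
      nlinarith [Nat.pos_of_ne_zero hnc0]
    have h5 : P.ramificationIdxIn (𝓞 K) * P.inertiaDegIn (𝓞 K) ≠ 0 := by
      intro h; rw [h, mul_zero] at hmain; exact hcard0 hmain.symm
    have h6 : P.ramificationIdxIn (𝓞 K) * P.inertiaDegIn (𝓞 K) = 1 := by omega
    exact Nat.eq_one_of_mul_eq_one_left h6
  rw [← Ideal.absNorm_pow_inertiaDeg P Q, ← Ideal.inertiaDegIn_eq_inertiaDeg P Q Gal(K/F), hf1,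
    pow_one]

open Pointwise in
lemma kummer_local_global {F : Type*} [Field F] [NumberField F] (n : ℕ) (hn : 0 < n) (ζ : F)
    (hζ : IsPrimitiveRoot ζ n) (a : 𝓞 F) (ha : a ≠ 0)
    (h : ∀ P : Ideal (𝓞 F), P.IsPrime → P ≠ ⊥ → (n : 𝓞 F) ∉ P → a ∉ P →
      ∃ x : 𝓞 F, x ^ n - a ∈ P) : ∃ b : F, b ^ n = a := by
  classical
  by_contra hno
  have : NeZero n := ⟨hn.ne'⟩
  let f : F[X] := X ^ n - C (a : F)
  let K := f.SplittingField
  have : CharZero K := charZero_of_injective_algebraMap (algebraMap F K).injective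
  have : FiniteDimensional F K := inferInstance
  have : FiniteDimensional ℚ K := FiniteDimensional.trans ℚ F K
  have : NumberField K := ⟨⟩
  have : IsGalois F K := { }
  have hdeg : f.degree = n := degree_X_pow_sub_C hn _
  have hsp := SplittingField.splits f
  obtain ⟨b, hb⟩ : ∃ b : K, b ^ n = algebraMap F K a := by
    obtain ⟨b, hb⟩ := hsp.exists_eval_eq_zero (by
      rw [degree_map, hdeg]; exact_mod_cast hn.ne')
    refine ⟨b, ?_⟩
    simp [f] at hb
    exact sub_eq_zero.mp hb
  have hbint : IsIntegral ℤ b := by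
    apply IsIntegral.of_pow hn
    rw [hb]
    exact (RingOfIntegers.isIntegral_coe a).map (algebraMap F K).toIntAlgHom
  obtain ⟨β, hβb⟩ : ∃ β : 𝓞 K, algebraMap (𝓞 K) K β = b := ⟨⟨b, hbint⟩, rfl⟩
  have hβ : β ^ n = algebraMap (𝓞 F) (𝓞 K) a := by
    apply RingOfIntegers.coe_injective
    rw [map_pow, hβb, hb]; rfl
  have hb0 : b ≠ 0 := by
    rintro rfl
    rw [zero_pow hn.ne'] at hb
    apply ha
    apply RingOfIntegers.coe_injective
    exact (map_eq_zero _).mp hb.symm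
  have hgen : ∀ σ : Gal(K/F), σ • β = β → σ = 1 := by
    intro σ hσ
    have hσb : σ b = b := by
      rw [← hβb]
      exact congrArg (fun z : 𝓞 K => (z : K)) hσ
    have hζK : IsPrimitiveRoot (algebraMap F K ζ) n :=
      hζ.map_of_injective (algebraMap F K).injective
    have : (σ : K →ₐ[F] K) = AlgHom.id F K := by
      refine AlgHom.ext_of_adjoin_eq_top (SplittingField.adjoin_rootSet f) ?_
      intro c hc
      have hc' : c ^ n = algebraMap F K a := by
        have := (mem_rootSet.mp hc).2
        simp [f] at this
        exact sub_eq_zero.mp this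
      obtain ⟨i, -, hi⟩ := hζK.eq_pow_of_pow_eq_one (ξ := c / b) (by
        rw [div_pow, hc', hb, div_self]; rw [← hb]; exact pow_ne_zero n hb0)
      have hcb : c = (algebraMap F K ζ) ^ i * b := by rw [hi, div_mul_cancel₀ _ hb0]
      change σ c = c
      rw [hcb, map_mul, map_pow, σ.commutes, hσb]
    ext z
    exact DFunLike.congr_fun this z
  obtain ⟨σ, hσ⟩ : ∃ σ : Gal(K/F), σ ≠ 1 := by
    by_contra hcon
    push Not at hcon
    have : b ∈ (⊥ : IntermediateField F K) := by
      rw [IsGalois.mem_bot_iff_fixed]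
      intro τ; rw [hcon τ]; rfl
    obtain ⟨c, hc⟩ := IntermediateField.mem_bot.mp this
    apply hno
    refine ⟨c, (algebraMap F K).injective ?_⟩
    rw [map_pow, hc, hb]
  let S : Finset (Ideal (𝓞 F)) :=
    (UniqueFactorizationMonoid.normalizedFactors (Ideal.span {(n : 𝓞 F) * a})).toFinset
  have hna : (n : 𝓞 F) * a ≠ 0 := mul_ne_zero (by exact_mod_cast hn.ne') ha
  have hspan : Ideal.span {(n : 𝓞 F) * a} ≠ 0 := by
    rw [Ne, Ideal.zero_eq_bot, Ideal.span_singleton_eq_bot]; exact hna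
  have hSnot : ∀ P : Ideal (𝓞 F), Prime P → P ∉ S → (n : 𝓞 F) ∉ P ∧ a ∉ P := by
    intro P hP hPS
    have hmem : (n : 𝓞 F) * a ∉ P := by
      intro hm
      apply hPS
      rw [Multiset.mem_toFinset, UniqueFactorizationMonoid.mem_normalizedFactors_iff' hspan]
      refine ⟨hP.irreducible, normalize_eq _, ?_⟩
      rw [Ideal.dvd_span_singleton]; exact hm
    exact ⟨fun h => hmem (P.mul_mem_right _ h), fun h => hmem (P.mul_mem_left _ h)⟩
  have hex : ∀ P : Ideal (𝓞 F), ∃ Q : Ideal (𝓞 K), P.IsPrime → (Q.IsPrime ∧ Q.LiesOver P) := by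
    intro P
    by_cases hP : P.IsPrime
    · obtain ⟨Q, hQ⟩ := Ideal.nonempty_primesOver (S := 𝓞 K) P
      exact ⟨Q, fun _ => hQ⟩
    · exact ⟨⊥, fun h => absurd h hP⟩
  choose q hq using hex
  have key : ∀ P : Ideal (𝓞 F), Prime P → P ∉ S → ∀ Q : Ideal (𝓞 K), Q.IsPrime → Q.LiesOver P →
      Prime Q ∧ Ideal.comap (algebraMap (𝓞 F) (𝓞 K)) Q = P ∧
        Ideal.absNorm Q = Ideal.absNorm P := by
    intro P hP hPS Q hQ hQP
    have hPp := Ideal.isPrime_of_prime hP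
    have h1 := (kummer_split n hn ζ hζ a β hβ hgen P hPp (hSnot P hP hPS).1 (hSnot P hP hPS).2
      (h P hPp hP.ne_zero (hSnot P hP hPS).1 (hSnot P hP hPS).2) Q hQ hQP).2
    refine ⟨Ideal.prime_of_isPrime ?_ hQ, hQP.over.symm, h1⟩
    rintro rfl
    rw [Ideal.absNorm_bot, eq_comm, Ideal.absNorm_eq_zero_iff] at h1
    exact hP.ne_zero h1
  refine no_double S q (fun P => σ • q P) ?_ (Ideal.comap (algebraMap (𝓞 F) (𝓞 K))) ?_ ?_ ?_
  · intro P hP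
    exact Ideal.isPrime_of_prime
      (UniqueFactorizationMonoid.prime_of_normalized_factor P (Multiset.mem_toFinset.mp hP))
  · intro P hP hPS
    have := hq P (Ideal.isPrime_of_prime hP)
    exact key P hP hPS _ this.1 this.2
  · intro P hP hPS
    have := hq P (Ideal.isPrime_of_prime hP)
    have i1 := this.1
    have i2 := this.2
    exact key P hP hPS _ inferInstance inferInstance
  · intro P hP hPS heq
    have hPp := Ideal.isPrime_of_prime hP
    have := hq P hPp
    exact hσ ((kummer_split n hn ζ hζ a β hβ hgen P hPp (hSnot P hP hPS).1 (hSnot P hP hPS).2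
      (h P hPp hP.ne_zero (hSnot P hP hPS).1 (hSnot P hP hPS).2) _ this.1 this.2).1 σ heq.symm)

lemma approx_int {R K : Type*} [CommRing R] [IsDedekindDomain R] [Field K] [Algebra R K]
    [IsFractionRing R K] (v : HeightOneSpectrum R) (x : v.adicCompletion K)
    (hx : Valued.v x ≤ 1) :
    ∃ r : R, Valued.v (x - algebraMap K (v.adicCompletion K) (algebraMap R K r)) < 1 := by
  have hopen : IsOpen {y : v.adicCompletion K | Valued.v (y - x) < 1} := by
    have h1 : IsOpen {y : v.adicCompletion K | Valued.v y < 1} := by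
      have h0 := Valued.isOpen_ball (v.adicCompletion K) 1
      simp_rw [Valuation.restrict_lt_iff_lt_embedding, map_one] at h0
      exact h0
    exact h1.preimage (continuous_id.sub continuous_const)
  obtain ⟨k, hk⟩ := (denseRange_algebraMap K v).exists_mem_open hopen ⟨x, by simp⟩
  have hk' : Valued.v (algebraMap K (v.adicCompletion K) k - x) < 1 := hk
  have hk1 : v.valuation K k ≤ 1 := by
    rw [← valuedAdicCompletion_eq_valuation' v k]
    change Valued.v (algebraMap K (v.adicCompletion K) k) ≤ 1
    have : algebraMap K (v.adicCompletion K) k = (algebraMap K (v.adicCompletion K) k - x) + x := by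
      ring
    rw [this]
    exact (Valuation.map_add _ _ _).trans (max_le hk'.le hx)
  obtain ⟨r, hr⟩ := exists_valuation_sub_lt_of_integer v hk1 1
  refine ⟨r, ?_⟩
  rw [← valuedAdicCompletion_eq_valuation' v] at hr
  have hr' : Valued.v (algebraMap K (v.adicCompletion K) (algebraMap R K r - k)) < 1 := hr
  have : x - algebraMap K (v.adicCompletion K) (algebraMap R K r) =
      -((algebraMap K (v.adicCompletion K) k - x) +
        algebraMap K (v.adicCompletion K) (algebraMap R K r - k)) := by
    rw [map_sub]; ring
  rw [this, Valuation.map_neg]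
  exact (Valuation.map_add _ _ _).trans_lt (max_lt hk' hr')

lemma local_residue {R K : Type*} [CommRing R] [IsDedekindDomain R] [Field K] [Algebra R K]
    [IsFractionRing R K] (v : HeightOneSpectrum R) (n : ℕ) (hn : 0 < n) (a : R)
    (h : ∃ x : v.adicCompletion K, x ^ n = algebraMap K (v.adicCompletion K) (algebraMap R K a)) :
    ∃ y : R, y ^ n - a ∈ v.asIdeal := by
  obtain ⟨x, hx⟩ := h
  have hvle : ∀ r : R, Valued.v (algebraMap K (v.adicCompletion K) (algebraMap R K r)) ≤ 1 := by
    intro r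
    have := valuedAdicCompletion_eq_valuation' v (algebraMap R K r)
    change Valued.v (algebraMap K (v.adicCompletion K) (algebraMap R K r)) = _ at this
    rw [this]
    exact v.valuation_le_one r
  have hx1 : Valued.v x ≤ 1 := by
    have : Valued.v x ^ n ≤ 1 := by
      rw [← map_pow, hx]; exact hvle a
    exact (pow_le_one_iff hn.ne').mp this
  obtain ⟨r, hr⟩ := approx_int v x hx1
  refine ⟨r, ?_⟩
  rw [← v.valuation_lt_one_iff_mem (K := K), ← valuedAdicCompletion_eq_valuation' v]
  change Valued.v (algebraMap K (v.adicCompletion K) (algebraMap R K (r ^ n - a))) < 1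
  rw [map_sub, map_sub, ← hx, map_pow, map_pow]
  obtain ⟨g, hg⟩ := sub_dvd_pow_sub_pow (⟨x, hx1⟩ : v.adicCompletionIntegers K)
    ⟨algebraMap K (v.adicCompletion K) (algebraMap R K r), hvle r⟩ n
  have hg' := congrArg (fun z : v.adicCompletionIntegers K => (z : v.adicCompletion K)) hg
  push_cast at hg'
  rw [Valuation.map_sub_swap, hg', map_mul]
  have hgle : Valued.v (g : v.adicCompletion K) ≤ 1 := g.2
  exact mul_lt_one_of_lt_of_le hr hgle

lemma local_to_cyclo {L : Type*} [Field L] [NumberField L] (n : ℕ) [NeZero n] (a : L) (ha : a ≠ 0)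
    (h : ∀ v : HeightOneSpectrum (𝓞 L),
      ∃ x : v.adicCompletion L, x ^ n = algebraMap L (v.adicCompletion L) a) :
    ∃ b : CyclotomicField n L, b ^ n = algebraMap L _ a := by
  have hn : 0 < n := Nat.pos_of_ne_zero (NeZero.ne n)
  obtain ⟨u, d, hd, hud⟩ := IsFractionRing.div_surjective (A := 𝓞 L) a
  have hd0 : algebraMap (𝓞 L) L d ≠ 0 := by
    intro h0
    exact nonZeroDivisors.ne_zero hd (RingOfIntegers.coe_injective (by rw [h0, map_zero]))
  let a0 : 𝓞 L := u * d ^ (n - 1)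
  have ha0 : algebraMap (𝓞 L) L a0 = a * (algebraMap (𝓞 L) L d) ^ n := by
    simp only [a0, map_mul, map_pow]
    rw [← hud]
    obtain ⟨k, rfl⟩ : ∃ k, n = k + 1 := ⟨n - 1, by omega⟩
    rw [Nat.add_sub_cancel]
    field_simp
    ring
  have ha0' : a0 ≠ 0 := by
    intro h0
    rw [h0, map_zero] at ha0
    exact mul_ne_zero ha (pow_ne_zero n hd0) ha0.symm
  let F := CyclotomicField n L
  have hζ : IsPrimitiveRoot (IsCyclotomicExtension.zeta n L F) n :=
    IsCyclotomicExtension.zeta_spec n L F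
  obtain ⟨b, hb⟩ := kummer_local_global (F := F) n hn _ hζ (algebraMap (𝓞 L) (𝓞 F) a0)
    (by
      rw [Ne, map_eq_zero_iff _ (FaithfulSMul.algebraMap_injective (𝓞 L) (𝓞 F))]
      exact ha0')
    (by
      intro P hP hP0 _ _
      have hp0 : P.comap (algebraMap (𝓞 L) (𝓞 F)) ≠ ⊥ := by
        intro hbot
        exact hP0 (Ideal.eq_bot_of_comap_eq_bot hbot)
      let v : HeightOneSpectrum (𝓞 L) := ⟨P.comap (algebraMap (𝓞 L) (𝓞 F)), inferInstance, hp0⟩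
      obtain ⟨x, hx⟩ := h v
      obtain ⟨y, hy⟩ := local_residue (K := L) v n hn a0
        ⟨x * algebraMap L (v.adicCompletion L) (algebraMap (𝓞 L) L d), by
          rw [mul_pow, hx, ha0, map_mul, map_pow]⟩
      refine ⟨algebraMap (𝓞 L) (𝓞 F) y, ?_⟩
      rw [← map_pow, ← map_sub]
      exact hy)
  have hb' : b ^ n = algebraMap L F (algebraMap (𝓞 L) L a0) := hb
  have hd1 : algebraMap L F (algebraMap (𝓞 L) L d) ≠ 0 := by
    rwa [Ne, map_eq_zero_iff _ (algebraMap L F).injective]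
  refine ⟨b / algebraMap L F (algebraMap (𝓞 L) L d), ?_⟩
  rw [div_pow, hb', ha0, map_mul, map_pow, mul_div_assoc, div_self (pow_ne_zero n hd1), mul_one]

lemma conj_step {L : Type*} [Field L] [NumberField L] (ι : L →+* ℝ) (n : ℕ) [NeZero n] (a : L)
    (ha : a ≠ 0) (b : CyclotomicField n L) (hb : b ^ n = algebraMap L _ a) :
    ∃ c : L, c ^ n = a ^ 2 := by
  let F := CyclotomicField n L
  have hn : 0 < n := Nat.pos_of_ne_zero (NeZero.ne n)
  let _ : Algebra L ℂ := ((algebraMap ℝ ℂ).comp ι).toAlgebra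
  have hmap : ∀ l : L, algebraMap L ℂ l = ((ι l : ℝ) : ℂ) := fun l => rfl
  have : Algebra.IsAlgebraic L F := Algebra.IsAlgebraic.of_finite L F
  have hgal : IsGalois L F := IsCyclotomicExtension.isGalois {n} L F
  have hcomm : ∀ σ τ : Gal(F/L), σ * τ = τ * σ := by
    have : IsMulCommutative Gal(F/L) := IsCyclotomicExtension.isMulCommutative {n} L F
    exact fun σ τ => mul_comm' σ τ
  let φ : F →ₐ[L] ℂ := IsAlgClosed.lift
  let conj : ℂ →ₐ[L] ℂ :=
    { (starRingEnd ℂ) with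
      commutes' := fun l => by
        change (starRingEnd ℂ) (algebraMap L ℂ l) = _
        rw [hmap, Complex.conj_ofReal] }
  have hσ : ∃ σ : Gal(F/L), ∀ x, φ (σ x) = (starRingEnd ℂ) (φ x) := by
    let _ : Algebra F ℂ := φ.toRingHom.toAlgebra
    have : IsScalarTower L F ℂ := IsScalarTower.of_algebraMap_eq fun x => (φ.commutes x).symm
    let σ' : F →ₐ[L] F := AlgHom.restrictNormal' conj F |>.toAlgHom
    refine ⟨AlgHom.restrictNormal' conj F, fun x => ?_⟩
    exact AlgHom.restrictNormal_commutes conj F x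
  obtain ⟨σ, hσ⟩ := hσ
  have hroot : ∀ ω : F, ω ^ n = 1 → σ ω = ω⁻¹ := by
    intro ω hω
    apply φ.toRingHom.injective
    change φ (σ ω) = φ ω⁻¹
    rw [hσ, map_inv₀]
    have h1 : (φ ω) ^ n = 1 := by rw [← map_pow, hω, map_one]
    have h2 : ‖φ ω‖ = 1 := Complex.norm_eq_one_of_pow_eq_one h1 hn.ne'
    rw [Complex.inv_def, Complex.normSq_eq_norm_sq, h2]
    simp
  have hb0 : b ≠ 0 := by
    rintro rfl
    rw [zero_pow hn.ne'] at hb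
    exact ha ((map_eq_zero _).mp hb.symm)
  have hfix : b * σ b ∈ (⊥ : IntermediateField L F) := by
    rw [IsGalois.mem_bot_iff_fixed]
    intro τ
    have hω : (τ b / b) ^ n = 1 := by
      rw [div_pow, ← map_pow, hb, τ.commutes, div_self]
      rwa [Ne, map_eq_zero]
    have h1 : σ (τ b) = (τ b / b)⁻¹ * σ b := by
      rw [← hroot _ hω, ← map_mul, div_mul_cancel₀ _ hb0]
    have h2 : τ (σ b) = σ (τ b) := DFunLike.congr_fun (hcomm τ σ) b
    have hτb : τ b ≠ 0 := by rwa [Ne, map_eq_zero]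
    rw [map_mul, h2, h1]
    field_simp
  obtain ⟨c, hc⟩ := IntermediateField.mem_bot.mp hfix
  refine ⟨c, (algebraMap L F).injective ?_⟩
  rw [map_pow, hc, mul_pow, ← map_pow σ, hb, σ.commutes, map_pow, sq]


/-- The tower of iterated square roots `√2, √(2+√2), …`. -/
noncomputable def etaR : ℕ → ℝ
  | 0 => alpha ^ 2
  | (j + 1) => Real.sqrt (2 + etaR j)

lemma alpha_pos : 0 < alpha := by
  unfold alpha
  positivity

lemma eta_pos : ∀ j, 0 < etaR j
  | 0 => by
    have := alpha_pos
    simp only [etaR]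
    positivity
  | (j + 1) => by
    have := eta_pos j
    simp only [etaR]
    positivity

lemma eta_sq (j : ℕ) : etaR (j + 1) ^ 2 = 2 + etaR j := by
  have := eta_pos j
  simp only [etaR]
  exact Real.sq_sqrt (by positivity)

/-- Real fields generated by the tower. -/
noncomputable def tower : ℕ → Subfield ℝ
  | 0 => L.toSubfield
  | (j + 1) => Subfield.closure (tower j ∪ {etaR (j + 1)})

/-- Explicit quadratic extension of a real subfield. -/
def quadExt (K : Subfield ℝ) (e : ℝ) (he : e ^ 2 ∈ K) : Subfield ℝ where
  carrier := {z | ∃ x ∈ K, ∃ y ∈ K, z = x + y * e}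
  mul_mem' := by
    rintro _ _ ⟨x, hx, y, hy, rfl⟩ ⟨x', hx', y', hy', rfl⟩
    refine ⟨x * x' + y * y' * e ^ 2, ?_, x * y' + y * x', ?_, by ring⟩
    · exact K.add_mem (K.mul_mem hx hx') (K.mul_mem (K.mul_mem hy hy') he)
    · exact K.add_mem (K.mul_mem hx hy') (K.mul_mem hy hx')
  one_mem' := ⟨1, K.one_mem, 0, K.zero_mem, by ring⟩
  add_mem' := by
    rintro _ _ ⟨x, hx, y, hy, rfl⟩ ⟨x', hx', y', hy', rfl⟩
    exact ⟨x + x', K.add_mem hx hx', y + y', K.add_mem hy hy', by ring⟩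
  zero_mem' := ⟨0, K.zero_mem, 0, K.zero_mem, by ring⟩
  neg_mem' := by
    rintro _ ⟨x, hx, y, hy, rfl⟩
    exact ⟨-x, K.neg_mem hx, -y, K.neg_mem hy, by ring⟩
  inv_mem' := by
    rintro _ ⟨x, hx, y, hy, rfl⟩
    by_cases h : x - y * e = 0
    · have h2 : x + y * e = x + x := by linarith
      rw [h2]
      exact ⟨(x + x)⁻¹, K.inv_mem (K.add_mem hx hx), 0, K.zero_mem, by ring⟩
    · by_cases h3 : x + y * e = 0
      · rw [h3]
        exact ⟨0, K.zero_mem, 0, K.zero_mem, by simp⟩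
      · have hN : x * x - y * y * e ^ 2 ∈ K :=
          K.sub_mem (K.mul_mem hx hx) (K.mul_mem (K.mul_mem hy hy) he)
        have hN0 : x * x - y * y * e ^ 2 ≠ 0 := by
          have : x * x - y * y * e ^ 2 = (x - y * e) * (x + y * e) := by ring
          rw [this]
          exact mul_ne_zero h h3
        refine ⟨x * (x * x - y * y * e ^ 2)⁻¹, K.mul_mem hx (K.inv_mem hN),
          -y * (x * x - y * y * e ^ 2)⁻¹, K.mul_mem (K.neg_mem hy) (K.inv_mem hN), ?_⟩
        symm
        apply eq_inv_of_mul_eq_one_left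
        linear_combination mul_inv_cancel₀ hN0

lemma tower_le (j : ℕ) : tower j ≤ tower (j + 1) := fun _ hx =>
  Subfield.subset_closure (Or.inl hx)

lemma L_le_tower (j : ℕ) {x : ℝ} (hx : x ∈ L) : x ∈ tower j := by
  induction j with
  | zero => exact hx
  | succ j ih => exact tower_le j ih

lemma alpha_mem : alpha ∈ L := IntermediateField.mem_adjoin_simple_self ℚ alpha

lemma eta_mem : ∀ j, etaR j ∈ tower j
  | 0 => L.pow_mem alpha_mem 2
  | (_ + 1) => Subfield.subset_closure (Or.inr rfl)

lemma two_mem (K : Subfield ℝ) : (2 : ℝ) ∈ K := ofNat_mem K 2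

lemma tower_mem (j : ℕ) {z : ℝ} (hz : z ∈ tower (j + 1)) :
    ∃ x ∈ tower j, ∃ y ∈ tower j, z = x + y * etaR (j + 1) := by
  have he : etaR (j + 1) ^ 2 ∈ tower j := by
    rw [eta_sq]
    exact add_mem (two_mem _) (eta_mem j)
  have : tower (j + 1) ≤ quadExt (tower j) (etaR (j + 1)) he := by
    refine Subfield.closure_le.mpr ?_
    rintro w (hw | hw)
    · exact ⟨w, hw, 0, zero_mem _, by ring⟩
    · rw [Set.mem_singleton_iff] at hw
      exact ⟨0, zero_mem _, 1, one_mem _, by rw [hw]; ring⟩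
  exact this hz

lemma lin_indep {K : Subfield ℝ} {e : ℝ} (he : e ∉ K) {x y : ℝ} (hx : x ∈ K) (hy : y ∈ K)
    (h : x + y * e = 0) : x = 0 ∧ y = 0 := by
  have hy0 : y = 0 := by
    by_contra hy0
    apply he
    have : e = -x / y := by field_simp; linarith
    rw [this]
    exact div_mem (neg_mem hx) hy
  subst hy0
  exact ⟨by linarith, rfl⟩

lemma tower_N (h0 : ∀ x ∈ L, x ^ 2 ≠ 2 + alpha ^ 2) (j : ℕ) :
    ∀ x ∈ tower j, x ^ 2 ≠ 2 - etaR j ∧ x ^ 2 ≠ 2 + etaR j := by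
  induction j with
  | zero =>
    intro x hx
    refine ⟨?_, h0 x hx⟩
    intro h
    change x ^ 2 = 2 - alpha ^ 2 at h
    have h4 := alpha_pow4
    have hx0 : x ≠ 0 := by
      rintro rfl
      have h5 : alpha ^ 2 = 2 := by linarith
      have : alpha ^ 4 = 4 := by
        rw [show alpha ^ 4 = (alpha ^ 2) ^ 2 by ring, h5]; norm_num
      linarith
    refine h0 (alpha ^ 2 / x) (div_mem (pow_mem alpha_mem 2) hx) ?_
    rw [div_pow, div_eq_iff (pow_ne_zero 2 hx0), h]
    linear_combination 2 * h4
  | succ j ih =>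
    have hne : etaR (j + 1) ∉ tower j := fun h => (ih _ h).2 (eta_sq j)
    have hs : etaR j ∈ tower j := eta_mem j
    have key : ∀ ε : ℝ, ε ^ 2 = 1 → ε ∈ tower j → ∀ x ∈ tower (j + 1),
        x ^ 2 ≠ 2 + ε * etaR (j + 1) := by
      intro ε hε hεm z hz h
      obtain ⟨x, hx, y, hy, rfl⟩ := tower_mem j hz
      have hsq := eta_sq j
      have hsm : 2 + etaR j ∈ tower j := add_mem (two_mem _) hs
      obtain ⟨h1, h2⟩ := lin_indep hne (x := x ^ 2 + y ^ 2 * (2 + etaR j) - 2)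
        (y := 2 * (x * y) - ε)
        (sub_mem (add_mem (pow_mem hx 2) (mul_mem (pow_mem hy 2) hsm)) (two_mem _))
        (sub_mem (mul_mem (two_mem _) (mul_mem hx hy)) hεm)
        (by linear_combination h - y ^ 2 * hsq)
      refine (ih (x ^ 2 - y ^ 2 * (2 + etaR j))
        (sub_mem (pow_mem hx 2) (mul_mem (pow_mem hy 2) hsm))).1 ?_
      linear_combination (x ^ 2 + y ^ 2 * (2 + etaR j) + 2) * h1 -
        (2 + etaR j) * (2 * (x * y) + ε) * h2 - (2 + etaR j) * hε
    intro x hx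
    constructor
    · intro h
      exact key (-1) (by norm_num) (neg_mem (one_mem _)) x hx (by rw [h]; ring)
    · intro h
      exact key 1 (by norm_num) (one_mem _) x hx (by rw [h]; ring)

lemma tower_A (h0 : ∀ x ∈ L, x ^ 2 ≠ 2 + alpha ^ 2) (c : ℝ) (hc : c ∈ L) (j : ℕ) :
    ∀ x ∈ tower j, x ^ 2 = c → ∃ d ∈ L, c = d ^ 2 ∨ c = (2 + alpha ^ 2) * d ^ 2 := by
  by_cases hc0 : c = 0
  · intro _ _ _
    exact ⟨0, zero_mem _, Or.inl (by rw [hc0]; ring)⟩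
  induction j with
  | zero =>
    intro x hx h
    exact ⟨x, hx, Or.inl h.symm⟩
  | succ j ih =>
    intro z hz h
    have hne : etaR (j + 1) ∉ tower j := fun h => (tower_N h0 j _ h).2 (eta_sq j)
    obtain ⟨x, hx, y, hy, rfl⟩ := tower_mem j hz
    have hsq := eta_sq j
    have hsm : 2 + etaR j ∈ tower j := add_mem (two_mem _) (eta_mem j)
    obtain ⟨h1, h2⟩ := lin_indep hne (x := x ^ 2 + y ^ 2 * (2 + etaR j) - c) (y := 2 * (x * y))
        (sub_mem (add_mem (pow_mem hx 2) (mul_mem (pow_mem hy 2) hsm)) (L_le_tower j hc))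
        (mul_mem (two_mem _) (mul_mem hx hy))
        (by linear_combination h - y ^ 2 * hsq)
    have hxy : x * y = 0 := by linarith
    rcases mul_eq_zero.mp hxy with h3 | h3
    · subst h3
      have hcy : c = y ^ 2 * (2 + etaR j) := by linarith
      match j, hy, hcy with
      | 0, hy, hcy => exact ⟨y, hy, Or.inr (by rw [hcy]; simp only [etaR]; ring)⟩
      | (i + 1), hy, hcy =>
        exfalso
        have hne' : etaR (i + 1) ∉ tower i := fun h => (tower_N h0 i _ h).2 (eta_sq i)
        obtain ⟨u, hu, w, hw, rfl⟩ := tower_mem i hy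
        have hsq' := eta_sq i
        have hsm' : 2 + etaR i ∈ tower i := add_mem (two_mem _) (eta_mem i)
        have hcm : c ∈ tower i := L_le_tower i hc
        set s := 2 + etaR i with hs
        obtain ⟨h4, h5⟩ := lin_indep hne' (x := 2 * (u ^ 2 + w ^ 2 * s) + 2 * (u * w * s) - c)
          (y := u ^ 2 + w ^ 2 * s + 2 * 2 * (u * w))
          (sub_mem (add_mem (mul_mem (two_mem _) (add_mem (pow_mem hu 2)
            (mul_mem (pow_mem hw 2) hsm')))
            (mul_mem (two_mem _) (mul_mem (mul_mem hu hw) hsm'))) hcm)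
          (add_mem (add_mem (pow_mem hu 2) (mul_mem (pow_mem hw 2) hsm'))
            (mul_mem (mul_mem (two_mem _) (two_mem _)) (mul_mem hu hw)))
          (by linear_combination -hcy - (2 * w ^ 2 + 2 * u * w + w ^ 2 * etaR (i + 1)) * hsq')
        have hcv : c = 2 * (u * w) * (s - 4) := by linear_combination 2 * h5 - h4
        have hD : (u ^ 2 - w ^ 2 * s) ^ 2 = 4 * (u * w) ^ 2 * (4 - s) := by
          linear_combination (u ^ 2 + w ^ 2 * s - 4 * (u * w)) * h5
        have hc2 : c ^ 2 = (u ^ 2 - w ^ 2 * s) ^ 2 * (4 - s) := by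
          rw [hD, hcv]; ring
        have hD0 : u ^ 2 - w ^ 2 * s ≠ 0 := by
          intro h6
          rw [h6] at hc2
          apply hc0
          have : c ^ 2 = 0 := by rw [hc2]; ring
          exact pow_eq_zero_iff (two_ne_zero) |>.mp this
        refine (tower_N h0 i (c / (u ^ 2 - w ^ 2 * s))
          (div_mem hcm (sub_mem (pow_mem hu 2) (mul_mem (pow_mem hw 2) hsm')))).1 ?_
        rw [div_pow, div_eq_iff (pow_ne_zero 2 hD0), hc2, hs]
        ring
    · subst h3
      exact ih x hx (by linarith)

/-- Complex numbers with real and imaginary part in `K`. -/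
def cxExt (K : Subfield ℝ) : Subfield ℂ where
  carrier := {z | z.re ∈ K ∧ z.im ∈ K}
  mul_mem' := by
    rintro a b ⟨ha, ha'⟩ ⟨hb, hb'⟩
    constructor
    · rw [Complex.mul_re]
      exact sub_mem (mul_mem ha hb) (mul_mem ha' hb')
    · rw [Complex.mul_im]
      exact add_mem (mul_mem ha hb') (mul_mem ha' hb)
  one_mem' := ⟨by simp [one_mem], by simp [zero_mem]⟩
  add_mem' := by
    rintro a b ⟨ha, ha'⟩ ⟨hb, hb'⟩
    exact ⟨by rw [Complex.add_re]; exact add_mem ha hb, by rw [Complex.add_im]; exact add_mem ha' hb'⟩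
  zero_mem' := ⟨by simp [zero_mem], by simp [zero_mem]⟩
  neg_mem' := by
    rintro a ⟨ha, ha'⟩
    exact ⟨by rw [Complex.neg_re]; exact neg_mem ha, by rw [Complex.neg_im]; exact neg_mem ha'⟩
  inv_mem' := by
    rintro a ⟨ha, ha'⟩
    have hn : Complex.normSq a ∈ K := by
      rw [Complex.normSq_apply]
      exact add_mem (mul_mem ha ha) (mul_mem ha' ha')
    constructor
    · rw [Complex.inv_re]
      exact div_mem ha hn
    · rw [Complex.inv_im]
      exact div_mem (neg_mem ha') hn

lemma ofReal_mem_cx {K : Subfield ℝ} {x : ℝ} (hx : x ∈ K) : (x : ℂ) ∈ cxExt K :=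
  ⟨by simpa using hx, by simp [zero_mem]⟩

lemma cxExt_mono {K K' : Subfield ℝ} (h : K ≤ K') : cxExt K ≤ cxExt K' := fun _ hz =>
  ⟨h hz.1, h hz.2⟩

/-- Roots of unity of 2-power order. -/
noncomputable def zt : ℕ → ℂ
  | 0 => ⟨alpha ^ 2 / 2, alpha ^ 2 / 2⟩
  | (j + 1) => (1 + zt j) / (etaR (j + 1) : ℂ)

lemma zt_mem : ∀ j, zt j ∈ cxExt (tower j)
  | 0 => by
    have h : alpha ^ 2 / 2 ∈ tower 0 := div_mem (L_le_tower 0 (pow_mem alpha_mem 2)) (two_mem _)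
    exact ⟨h, h⟩
  | (j + 1) => by
    simp only [zt]
    exact div_mem (add_mem (one_mem _) (cxExt_mono (tower_le j) (zt_mem j)))
      (ofReal_mem_cx (eta_mem _))

lemma zt0_sq : zt 0 ^ 2 = Complex.I := by
  have h4 := alpha_pow4
  simp only [zt]
  apply Complex.ext
  · simp [sq]
  · simp [sq]
    linear_combination h4 / 2

lemma zt_quad : ∀ j, zt j ^ 2 + 1 = (etaR j : ℂ) * zt j
  | 0 => by
    have h4 := alpha_pow4
    rw [zt0_sq]
    simp only [zt, etaR]
    apply Complex.ext
    · simp [-Complex.ofReal_pow]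
      linear_combination -h4 / 2
    · simp [-Complex.ofReal_pow]
      linear_combination -h4 / 2
  | (j + 1) => by
    have ih := zt_quad j
    have hsq : (etaR (j + 1) : ℂ) ^ 2 = 2 + etaR j := by exact_mod_cast congrArg Complex.ofReal (eta_sq j)
    have h0 : (etaR (j + 1) : ℂ) ≠ 0 := by exact_mod_cast (eta_pos (j + 1)).ne'
    simp only [zt]
    field_simp
    linear_combination ih + (- zt j) * hsq

lemma zt_sq (j : ℕ) : zt (j + 1) ^ 2 = zt j := by
  have ih := zt_quad j
  have hsq : (etaR (j + 1) : ℂ) ^ 2 = 2 + etaR j := by exact_mod_cast congrArg Complex.ofReal (eta_sq j)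
  have h0 : (etaR (j + 1) : ℂ) ≠ 0 := by exact_mod_cast (eta_pos (j + 1)).ne'
  simp only [zt]
  field_simp
  linear_combination ih + (- zt j) * hsq

lemma zt_pow (j : ℕ) : zt j ^ 2 ^ (j + 2) = -1 := by
  induction j with
  | zero =>
    rw [show 2 ^ (0 + 2) = 2 * 2 by norm_num, pow_mul, zt0_sq, Complex.I_sq]
  | succ j ih =>
    rw [show 2 ^ (j + 1 + 2) = 2 * 2 ^ (j + 2) by ring, pow_mul, zt_sq, ih]

lemma root_mem (r : ℕ) (ω : ℂ) (hω : ω ^ 2 ^ r = 1) : ω ∈ cxExt (tower r) := by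
  have h1 : orderOf (zt r) = 2 ^ (r + 2 + 1) := by
    apply orderOf_eq_prime_pow
    · rw [zt_pow]; norm_num
    · rw [pow_succ, pow_mul, zt_pow]; norm_num
  have h2 : IsPrimitiveRoot (zt r) (2 ^ (r + 2 + 1)) := h1 ▸ IsPrimitiveRoot.orderOf (zt r)
  obtain ⟨i, _, hi⟩ := h2.eq_pow_of_pow_eq_one (ξ := ω) (by
    rw [show 2 ^ (r + 2 + 1) = 2 ^ r * 8 by ring, pow_mul, hω, one_pow])
  rw [← hi]
  exact pow_mem (zt_mem r) i

lemma cyclo_image (r : ℕ) [NeZero (2 ^ r)] (c : L) (f : CyclotomicField (2 ^ r) L)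
    (hf : f ^ 2 = algebraMap L _ c) (h0 : ∀ x ∈ L, x ^ 2 ≠ 2 + alpha ^ 2) :
    ∃ d : L, ∃ e : L, (e = 1 ∨ e = -1) ∧
      (c = e * d ^ 2 ∨ c = e * (2 + (⟨alpha, alpha_mem⟩ : L) ^ 2) * d ^ 2) := by
  let F := CyclotomicField (2 ^ r) L
  let _ : Algebra L ℂ := ((algebraMap ℝ ℂ).comp (algebraMap L ℝ)).toAlgebra
  have hmap : ∀ l : L, algebraMap L ℂ l = ((l : ℝ) : ℂ) := fun l => rfl
  have : Algebra.IsAlgebraic L F := Algebra.IsAlgebraic.of_finite L F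
  let φ : F →ₐ[L] ℂ := IsAlgClosed.lift
  have hζ := IsCyclotomicExtension.zeta_spec (2 ^ r) L F
  have htop := IsCyclotomicExtension.adjoin_primitive_root_eq_top (A := L) hζ
  have hmem : ∀ x : F, φ x ∈ cxExt (tower r) := by
    intro x
    have hx : x ∈ Algebra.adjoin L {IsCyclotomicExtension.zeta (2 ^ r) L F} := by
      rw [htop]; trivial
    induction hx using Algebra.adjoin_induction with
    | mem x hx =>
      rw [Set.mem_singleton_iff] at hx
      apply root_mem
      rw [← map_pow, hx, hζ.pow_eq_one, map_one]
    | algebraMap l =>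
      rw [φ.commutes, hmap]
      exact ofReal_mem_cx (L_le_tower r l.2)
    | add x y _ _ hx hy => rw [map_add]; exact add_mem hx hy
    | mul x y _ _ hx hy => rw [map_mul]; exact mul_mem hx hy
  obtain ⟨hre, him⟩ := hmem f
  have hsq : (φ f) ^ 2 = ((c : ℝ) : ℂ) := by
    rw [← map_pow, hf, φ.commutes, hmap]
  have e1 := congrArg Complex.re hsq
  have e2 := congrArg Complex.im hsq
  simp only [sq, Complex.mul_re, Complex.mul_im, Complex.ofReal_re, Complex.ofReal_im] at e1 e2
  have e3 : (φ f).re * (φ f).im = 0 := by linarith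
  rcases mul_eq_zero.mp e3 with h3 | h3
  · obtain ⟨d, hd, h⟩ := tower_A h0 (-(c : ℝ)) (neg_mem c.2) r _ him (by
      rw [h3] at e1; linarith)
    refine ⟨⟨d, hd⟩, -1, Or.inr rfl, ?_⟩
    rcases h with h | h
    · left
      apply Subtype.ext
      push_cast
      linarith
    · right
      apply Subtype.ext
      change (c : ℝ) = -1 * (2 + alpha ^ 2) * d ^ 2
      linarith
  · obtain ⟨d, hd, h⟩ := tower_A h0 (c : ℝ) c.2 r _ hre (by
      rw [h3] at e1; linarith)
    refine ⟨⟨d, hd⟩, 1, Or.inl rfl, ?_⟩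
    rcases h with h | h
    · left
      apply Subtype.ext
      push_cast
      linarith
    · right
      apply Subtype.ext
      change (c : ℝ) = 1 * (2 + alpha ^ 2) * d ^ 2
      linarith

/-- The generator of `L` inside `L`. -/
noncomputable def alphaL : L := ⟨alpha, alpha_mem⟩

lemma alphaL_pow4 : alphaL ^ 4 = 2 := Subtype.ext alpha_pow4

/-- The generator of `L` as an algebraic integer. -/
noncomputable def alphaO : 𝓞 L := ⟨alphaL, by
  refine ⟨X ^ 4 - C 2, monic_X_pow_sub_C _ (by norm_num), ?_⟩
  simp [alphaL_pow4]⟩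

lemma alphaO_coe : algebraMap (𝓞 L) L alphaO = alphaL := rfl

lemma alphaO_pow4 : alphaO ^ 4 = 2 := by
  apply RingOfIntegers.coe_injective
  rw [map_pow, alphaO_coe, alphaL_pow4, map_ofNat]

lemma finrank_le : Module.finrank ℚ L ≤ 4 := by
  change Module.finrank ℚ ℚ⟮alpha⟯ ≤ 4
  rw [IntermediateField.adjoin.finrank alpha_int]
  have h1 : minpoly ℚ alpha ∣ X ^ 4 - C 2 := minpoly.dvd ℚ alpha (by simp [alpha_pow4])
  have h2 := natDegree_le_of_dvd h1 (monic_X_pow_sub_C (2 : ℚ) (by norm_num)).ne_zero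
  rwa [natDegree_X_pow_sub_C] at h2

lemma absNorm_alpha : Ideal.absNorm (Ideal.span {alphaO}) = 2 := by
  have h1 : Ideal.absNorm (Ideal.span {alphaO}) ^ 4 = 2 ^ Module.finrank ℚ L := by
    rw [← map_pow, Ideal.span_singleton_pow, alphaO_pow4, Ideal.absNorm_span_singleton,
      show (2 : 𝓞 L) = algebraMap ℤ (𝓞 L) 2 by simp, Algebra.norm_algebraMap,
      RingOfIntegers.rank]
    simp [Int.natAbs_pow]
  have h2 := finrank_le
  have h3 : 0 < Module.finrank ℚ L := Module.finrank_pos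
  set N := Ideal.absNorm (Ideal.span {alphaO})
  have h4 : N ^ 4 ≤ 2 ^ 4 := by rw [h1]; exact Nat.pow_le_pow_right (by norm_num) h2
  have h5 : N ≤ 2 := le_of_pow_le_pow_left₀ (by norm_num) (by norm_num) h4
  have h6 : 2 ^ 1 ≤ N ^ 4 := by rw [h1]; exact Nat.pow_le_pow_right (by norm_num) h3
  clear_value N
  clear h1 h4
  interval_cases N
  · norm_num at h6
  · norm_num at h6
  · rfl

/-- The prime above `2`. -/
noncomputable def v2 : HeightOneSpectrum (𝓞 L) where
  asIdeal := Ideal.span {alphaO}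
  isPrime := Ideal.isPrime_of_irreducible_absNorm (by rw [absNorm_alpha]; exact Nat.prime_two)
  ne_bot := by
    intro h
    have := absNorm_alpha
    rw [h, Ideal.absNorm_bot] at this
    omega

lemma residue_two (r : 𝓞 L) : r ∈ v2.asIdeal ∨ r - 1 ∈ v2.asIdeal := by
  have hcard : Nat.card (𝓞 L ⧸ v2.asIdeal) = 2 := by
    have := absNorm_alpha
    rwa [Ideal.absNorm_apply, Submodule.cardQuot_apply] at this
  have hfin : Finite (𝓞 L ⧸ v2.asIdeal) := Nat.finite_of_card_ne_zero (by omega)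
  have hp := v2.isPrime
  have hne : (1 : 𝓞 L ⧸ v2.asIdeal) ≠ 0 := one_ne_zero
  have key : ∀ q : 𝓞 L ⧸ v2.asIdeal, q = 0 ∨ q = 1 := by
    intro q
    by_contra hq
    push Not at hq
    have : Fintype (𝓞 L ⧸ v2.asIdeal) := Fintype.ofFinite _
    rw [Nat.card_eq_fintype_card] at hcard
    have h3 : 2 < Fintype.card (𝓞 L ⧸ v2.asIdeal) :=
      Fintype.two_lt_card_iff.mpr ⟨0, 1, q, hne.symm, hq.1.symm, hq.2.symm⟩
    omega
  rcases key (Ideal.Quotient.mk _ r) with h | h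
  · left; exact Ideal.Quotient.eq_zero_iff_mem.mp h
  · right
    rw [← Ideal.Quotient.eq_zero_iff_mem, map_sub, h, map_one, sub_self]

/-- The uniformizer at `2`. -/
noncomputable def piv : v2.adicCompletion L := algebraMap L (v2.adicCompletion L) alphaL

lemma piv_pow4 : piv ^ 4 = 2 := by
  rw [piv, ← map_pow, alphaL_pow4, map_ofNat]

lemma v_piv : Valued.v piv = WithZero.exp (-1 : ℤ) := by
  have h := valuedAdicCompletion_eq_valuation' v2 alphaL
  change Valued.v piv = _ at h
  rw [h, ← alphaO_coe, valuation_of_algebraMap]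
  exact v2.intValuation_singleton (fun h0 => by
    have := alphaO_pow4
    rw [h0] at this
    norm_num at this) rfl

lemma piv_ne : piv ≠ 0 := by
  intro h
  have := v_piv
  rw [h, map_zero] at this
  exact WithZero.exp_ne_zero this.symm

lemma v_div_piv {x : v2.adicCompletion L} (hx : Valued.v x < 1) :
    ∃ y : v2.adicCompletion L, Valued.v y ≤ 1 ∧ x = piv * y := by
  refine ⟨x / piv, ?_, by field_simp [piv_ne]⟩
  rw [map_div₀, v_piv]
  by_cases h0 : Valued.v x = 0
  · rw [h0]; simp
  rw [div_le_one₀ (WithZero.exp_pos)]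
  rw [← WithZero.exp_log h0, ← WithZero.exp_zero, WithZero.exp_lt_exp] at hx
  rw [← WithZero.exp_log h0, WithZero.exp_le_exp]
  omega

lemma expand (x : v2.adicCompletion L) (hx : Valued.v x ≤ 1) :
    ∃ y : v2.adicCompletion L, Valued.v y ≤ 1 ∧ (x = piv * y ∨ x = 1 + piv * y) := by
  obtain ⟨r, hr⟩ := approx_int v2 x hx
  have hv : ∀ s ∈ v2.asIdeal,
      Valued.v (algebraMap L (v2.adicCompletion L) (algebraMap (𝓞 L) L s)) < 1 := by
    intro s hs
    have h := valuedAdicCompletion_eq_valuation' v2 (algebraMap (𝓞 L) L s)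
    change Valued.v (algebraMap L (v2.adicCompletion L) (algebraMap (𝓞 L) L s)) = _ at h
    rw [h]
    exact (v2.valuation_lt_one_iff_mem s).mpr hs
  rcases residue_two r with h | h
  · have h1 : Valued.v x < 1 := by
      have : x = (x - algebraMap L (v2.adicCompletion L) (algebraMap (𝓞 L) L r)) +
        algebraMap L (v2.adicCompletion L) (algebraMap (𝓞 L) L r) := by ring
      rw [this]
      exact (Valuation.map_add _ _ _).trans_lt (max_lt hr (hv r h))
    obtain ⟨y, hy, hxy⟩ := v_div_piv h1
    exact ⟨y, hy, Or.inl hxy⟩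
  · have h1 : Valued.v (x - 1) < 1 := by
      have : x - 1 = (x - algebraMap L (v2.adicCompletion L) (algebraMap (𝓞 L) L r)) +
        algebraMap L (v2.adicCompletion L) (algebraMap (𝓞 L) L (r - 1)) := by
        rw [map_sub, map_sub, map_one, map_one]; ring
      rw [this]
      exact (Valuation.map_add _ _ _).trans_lt (max_lt hr (hv _ h))
    obtain ⟨y, hy, hxy⟩ := v_div_piv h1
    exact ⟨y, hy, Or.inr (by rw [← hxy]; ring)⟩

/-- Integers of the completion, as a subring. -/
noncomputable abbrev O2 : Subring (v2.adicCompletion L) := (Valued.v (R := v2.adicCompletion L)).integer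

lemma mem_O2 (x : v2.adicCompletion L) : x ∈ O2 ↔ Valued.v x ≤ 1 := Iff.rfl

lemma piv_int : piv ∈ O2 := by
  rw [mem_O2, v_piv, ← WithZero.exp_zero, WithZero.exp_le_exp]
  norm_num

lemma no_unit {y : v2.adicCompletion L} (hy : y ∈ O2) (h : 1 + piv * y = 0) : False := by
  have h1 : piv * (-y) = 1 := by linear_combination -h
  have h2 : Valued.v (piv * (-y)) < 1 := by
    rw [map_mul, Valuation.map_neg]
    refine mul_lt_one_of_lt_of_le ?_ hy
    rw [v_piv, ← WithZero.exp_zero, WithZero.exp_lt_exp]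
    norm_num
  rw [h1, map_one] at h2
  exact lt_irrefl _ h2

lemma int_of_sq {x u : v2.adicCompletion L} (h : x ^ 2 = u) (hu : u ∈ O2) : x ∈ O2 := by
  rw [mem_O2] at *
  have : Valued.v x ^ 2 ≤ 1 := by rw [← map_pow, h]; exact hu
  exact (pow_le_one_iff two_ne_zero).mp this

section nonsquares
variable {A : Type*} [CommRing A] [IsDomain A] {p : A}

lemma ns_neg_one (hp : p ^ 4 = 2) (hp0 : p ≠ 0) (ex : ∀ x : A, ∃ y, x = p * y ∨ x = 1 + p * y)
    (nu : ∀ y, 1 + p * y ≠ 0) (x : A) (hx : x ^ 2 = -1) : False := by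
  have hp2 : p ^ 2 ≠ 0 := pow_ne_zero 2 hp0
  obtain ⟨y, rfl | rfl⟩ := ex x
  · exact nu (p * y ^ 2) (by linear_combination hx)
  have E1 : p ^ 2 + p ^ 3 * y + y ^ 2 = 0 := by
    apply mul_left_cancel₀ hp2
    linear_combination hx + (1 + p * y) * hp
  obtain ⟨z, rfl | rfl⟩ := ex y
  swap
  · exact nu (p + p ^ 2 * (1 + p * z) + 2 * z + p * z ^ 2) (by linear_combination E1)
  have E2 : 1 + p ^ 2 * z + z ^ 2 = 0 := by
    apply mul_left_cancel₀ hp2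
    linear_combination E1
  obtain ⟨t, rfl | rfl⟩ := ex z
  · exact nu (p * (p * t) + p * t ^ 2) (by linear_combination E2)
  have E3 : p ^ 2 + 1 + p * t + p ^ 3 * t + t ^ 2 = 0 := by
    apply mul_left_cancel₀ hp2
    linear_combination E2 + (1 + p * t) * hp
  obtain ⟨s, rfl | rfl⟩ := ex t
  · exact nu (p + p * s + p ^ 3 * s + p * s ^ 2) (by linear_combination E3)
  have E4 : 1 + p * (1 + s + p + p ^ 2 * s + p ^ 2 + p ^ 3 * s + s ^ 2) = 0 := by
    apply mul_left_cancel₀ hp0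
    linear_combination E3 + (1 + p * s) * hp
  exact nu _ E4

lemma ns_pos (hp : p ^ 4 = 2) (hp0 : p ≠ 0) (ex : ∀ x : A, ∃ y, x = p * y ∨ x = 1 + p * y)
    (nu : ∀ y, 1 + p * y ≠ 0) (x : A) (hx : x ^ 2 = 1 + p ^ 2) : False := by
  have hp2 : p ^ 2 ≠ 0 := pow_ne_zero 2 hp0
  obtain ⟨z, rfl | rfl⟩ := ex x
  · exact nu (p - p * z ^ 2) (by linear_combination -hx)
  have E1 : p ^ 3 * z + z ^ 2 - 1 = 0 := by
    apply mul_left_cancel₀ hp2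
    linear_combination hx + (p * z) * hp
  obtain ⟨t, rfl | rfl⟩ := ex z
  · exact nu (-p ^ 3 * t - p * t ^ 2) (by linear_combination -E1)
  have E2 : p + p ^ 2 * t + p ^ 3 * t + t ^ 2 = 0 := by
    apply mul_left_cancel₀ hp2
    linear_combination E1 + (p * t) * hp
  obtain ⟨s, rfl | rfl⟩ := ex t
  swap
  · exact nu (1 + p * (1 + p * s) + p ^ 2 * (1 + p * s) + 2 * s + p * s ^ 2)
      (by linear_combination E2)
  have E3 : 1 + p * (p * s + p ^ 2 * s + s ^ 2) = 0 := by
    apply mul_left_cancel₀ hp0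
    linear_combination E2
  exact nu _ E3

lemma ns_neg (hp : p ^ 4 = 2) (hp0 : p ≠ 0) (ex : ∀ x : A, ∃ y, x = p * y ∨ x = 1 + p * y)
    (nu : ∀ y, 1 + p * y ≠ 0) (x : A) (hx : x ^ 2 = -(1 + p ^ 2)) : False := by
  have hp2 : p ^ 2 ≠ 0 := pow_ne_zero 2 hp0
  obtain ⟨z, rfl | rfl⟩ := ex x
  · exact nu (p + p * z ^ 2) (by linear_combination hx)
  have E1 : p ^ 2 + p ^ 3 * z + z ^ 2 + 1 = 0 := by
    apply mul_left_cancel₀ hp2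
    linear_combination hx + (1 + p * z) * hp
  obtain ⟨t, rfl | rfl⟩ := ex z
  · exact nu (p + p ^ 3 * t + p * t ^ 2) (by linear_combination E1)
  have E2 : 1 + p + p ^ 2 * t + p ^ 2 + p ^ 3 * t + t ^ 2 = 0 := by
    apply mul_left_cancel₀ hp2
    linear_combination E1 + (1 + p * t) * hp
  obtain ⟨s, rfl | rfl⟩ := ex t
  · exact nu (1 + p ^ 2 * s + p + p ^ 3 * s + p * s ^ 2) (by linear_combination E2)
  have E3 : 1 + p * (p ^ 4 + p ^ 2 + p * s + p + p ^ 2 * s + p ^ 3 * s + s ^ 2) = 0 := by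
    apply mul_left_cancel₀ hp0
    linear_combination E2 + (1 + p * s + p ^ 2) * hp
  exact nu _ E3

end nonsquares

/-- The uniformizer in the ring of integers. -/
noncomputable def pO : O2 := ⟨piv, piv_int⟩

lemma pO_pow : pO ^ 4 = 2 := Subtype.ext piv_pow4

lemma pO_ne : pO ≠ 0 := fun h => piv_ne (congrArg Subtype.val h)

lemma pO_ex (x : O2) : ∃ y, x = pO * y ∨ x = 1 + pO * y := by
  obtain ⟨y, hy, h⟩ := expand x.1 x.2
  refine ⟨⟨y, hy⟩, ?_⟩
  rcases h with h | h
  · exact Or.inl (Subtype.ext h)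
  · exact Or.inr (Subtype.ext h)

lemma pO_nu (y : O2) : 1 + pO * y ≠ 0 := fun h => no_unit y.2 (congrArg Subtype.val h)

lemma loc_neg_one (x : v2.adicCompletion L) (hx : x ^ 2 = -1) : False := by
  have hxO : x ∈ O2 := int_of_sq hx (neg_mem (one_mem _))
  exact ns_neg_one pO_pow pO_ne pO_ex pO_nu ⟨x, hxO⟩ (Subtype.ext hx)

lemma loc_pos (x : v2.adicCompletion L) (hx : x ^ 2 = 2 + piv ^ 2) : False := by
  have hx' : (x / piv) ^ 2 = 1 + piv ^ 2 := by
    rw [div_pow, div_eq_iff (pow_ne_zero 2 piv_ne), hx]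
    linear_combination -piv_pow4
  have hxO : x / piv ∈ O2 := int_of_sq hx' (add_mem (one_mem _) (pow_mem piv_int 2))
  exact ns_pos pO_pow pO_ne pO_ex pO_nu ⟨_, hxO⟩ (Subtype.ext hx')

lemma loc_neg (x : v2.adicCompletion L) (hx : x ^ 2 = -(2 + piv ^ 2)) : False := by
  have hx' : (x / piv) ^ 2 = -(1 + piv ^ 2) := by
    rw [div_pow, div_eq_iff (pow_ne_zero 2 piv_ne), hx]
    linear_combination piv_pow4
  have hxO : x / piv ∈ O2 := int_of_sq hx' (neg_mem (add_mem (one_mem _) (pow_mem piv_int 2)))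
  exact ns_neg pO_pow pO_ne pO_ex pO_nu ⟨_, hxO⟩ (Subtype.ext hx')

lemma ns_L (x : ℝ) (hx : x ∈ L) : x ^ 2 ≠ 2 + alpha ^ 2 := by
  intro h
  have h' : (⟨x, hx⟩ : L) ^ 2 = 2 + alphaL ^ 2 := Subtype.ext h
  apply loc_pos (algebraMap L _ ⟨x, hx⟩)
  rw [← map_pow, h', map_add, map_pow, map_ofNat]
  rfl

lemma two_pow_root {M : Type*} [Field M] (hM : ∀ x : M, x ^ 2 = -1 → False) (k : ℕ) (u : M)
    (hu : u ^ 2 ^ k = 1) : u = 1 ∨ u = -1 := by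
  induction k generalizing u with
  | zero => left; simpa using hu
  | succ k ih =>
    rw [pow_succ', pow_mul] at hu
    rcases ih _ hu with h | h
    · exact mul_self_eq_one_iff.mp (by rw [← sq]; exact h)
    · exact (hM u h).elim

lemma finish_sq (r : ℕ) [NeZero (2 ^ r)] (c : L) (hc0 : c ≠ 0) (f : CyclotomicField (2 ^ r) L)
    (hf : f ^ 2 = algebraMap L _ c)
    (hloc : ∃ x : v2.adicCompletion L, x ^ 2 = algebraMap L (v2.adicCompletion L) c) :
    ∃ d : L, d ^ 2 = c := by
  obtain ⟨x, hx⟩ := hloc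
  obtain ⟨d, e, he, h⟩ := cyclo_image r c f hf ns_L
  have hd0 : d ≠ 0 := by
    rintro rfl
    apply hc0
    rcases h with h | h <;> rw [h] <;> ring
  have hd1 : algebraMap L (v2.adicCompletion L) d ≠ 0 := by
    rwa [Ne, map_eq_zero]
  have hα : algebraMap L (v2.adicCompletion L) (2 + (⟨alpha, alpha_mem⟩ : L) ^ 2) = 2 + piv ^ 2 := by
    rw [map_add, map_pow, map_ofNat]
    rfl
  rcases h with h | h <;> rcases he with rfl | rfl
  · exact ⟨d, by rw [h]; ring⟩
  · exfalso
    apply loc_neg_one (x / algebraMap L _ d)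
    rw [div_pow, hx, h, map_mul, map_pow, map_neg, map_one]
    field_simp
  · exfalso
    apply loc_pos (x / algebraMap L _ d)
    rw [div_pow, hx, h, map_mul, map_mul, hα, map_pow, map_one]
    field_simp
  · exfalso
    apply loc_neg (x / algebraMap L _ d)
    rw [div_pow, hx, h, map_mul, map_mul, hα, map_pow, map_neg, map_one]
    field_simp

lemma two_power_case (k : ℕ) (a : L) (ha : a ≠ 0)
    (h : ∀ v : HeightOneSpectrum (𝓞 L),
      ∃ x : v.adicCompletion L, x ^ 2 ^ (k + 1) = algebraMap L (v.adicCompletion L) a) :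
    ∃ x : L, x ^ 2 ^ (k + 1) = a := by
  have hne : NeZero (2 ^ (k + 1)) := ⟨by positivity⟩
  obtain ⟨b, hb⟩ := local_to_cyclo (2 ^ (k + 1)) a ha h
  obtain ⟨c, hc⟩ := conj_step (algebraMap L ℝ) (2 ^ (k + 1)) a ha b hb
  obtain ⟨x, hx⟩ := h v2
  have hx0 : x ≠ 0 := by
    rintro rfl
    rw [zero_pow (by positivity)] at hx
    exact ha ((map_eq_zero _).mp hx.symm)
  have hc0 : c ≠ 0 := by
    rintro rfl
    rw [zero_pow (by positivity)] at hc
    exact ha (pow_eq_zero_iff two_ne_zero |>.mp hc.symm)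
  have hc1 : algebraMap L (v2.adicCompletion L) c ≠ 0 := by
    rwa [Ne, map_eq_zero]
  have claim : ∃ c' : L, c' ^ 2 ^ k = a ∧
      ∃ y : v2.adicCompletion L, y ^ 2 = algebraMap L (v2.adicCompletion L) c' := by
    rcases k with _ | k
    · exact ⟨a, by simp, x, by simpa using hx⟩
    have hac : a = c ^ 2 ^ (k + 1) ∨ a = -c ^ 2 ^ (k + 1) := by
      apply sq_eq_sq_iff_eq_or_eq_neg.mp
      rw [← hc]; ring
    have hac' : a = c ^ 2 ^ (k + 1) := by
      rcases hac with h1 | h1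
      · exact h1
      · exfalso
        apply loc_neg_one (x ^ 2 ^ (k + 1) / (algebraMap L _ c) ^ 2 ^ k)
        rw [div_pow, ← pow_mul, ← pow_succ, hx, h1, map_neg, map_pow, ← pow_mul, ← pow_succ,
          neg_div, div_self (pow_ne_zero _ hc1)]
    have hu : (algebraMap L (v2.adicCompletion L) c / x ^ 2) ^ 2 ^ (k + 1) = 1 := by
      rw [div_pow, ← pow_mul, ← pow_succ', hx, hac', map_pow, div_self (pow_ne_zero _ hc1)]
    have hx2 : x ^ 2 ≠ 0 := pow_ne_zero 2 hx0
    rcases two_pow_root loc_neg_one (k + 1) _ hu with h1 | h1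
    · refine ⟨c, hac'.symm, x, ?_⟩
      rw [div_eq_iff hx2] at h1
      rw [h1, one_mul]
    · refine ⟨-c, ?_, x, ?_⟩
      · rw [hac', Even.neg_pow]
        exact (Nat.even_pow.mpr ⟨even_two, by omega⟩)
      · rw [div_eq_iff hx2] at h1
        rw [map_neg, h1]; ring
  obtain ⟨c', hc', hloc⟩ := claim
  have hc0' : c' ≠ 0 := by
    rintro rfl
    rw [zero_pow (by positivity)] at hc'
    exact ha hc'.symm
  let F := CyclotomicField (2 ^ (k + 1)) L
  have hcF : algebraMap L F c' ≠ 0 := by rwa [Ne, map_eq_zero]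
  have hζ : IsPrimitiveRoot (IsCyclotomicExtension.zeta (2 ^ (k + 1)) L F) (2 ^ (k + 1)) :=
    IsCyclotomicExtension.zeta_spec (2 ^ (k + 1)) L F
  have hζ2 := hζ.pow (a := 2) (b := 2 ^ k) (by positivity) (by ring)
  have hξ : (b ^ 2 / algebraMap L F c') ^ 2 ^ k = 1 := by
    rw [div_pow, ← pow_mul, ← pow_succ', hb, ← hc', map_pow, div_self (pow_ne_zero _ hcF)]
  have hne' : NeZero (2 ^ k) := ⟨by positivity⟩
  obtain ⟨i, _, hi⟩ := hζ2.eq_pow_of_pow_eq_one hξ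
  have hz0 : IsCyclotomicExtension.zeta (2 ^ (k + 1)) L F ≠ 0 := hζ.ne_zero (by positivity)
  obtain ⟨d, hd⟩ := finish_sq (k + 1) c' hc0'
    (b / (IsCyclotomicExtension.zeta (2 ^ (k + 1)) L F) ^ i) (by
      rw [eq_div_iff hcF] at hi
      rw [div_pow, div_eq_iff (pow_ne_zero 2 (pow_ne_zero i hz0)), ← hi]
      ring) hloc
  exact ⟨d, by rw [pow_succ', pow_mul, hd, hc']⟩

lemma odd_case (k : ℕ) (hk : Odd k) (a : L) (ha : a ≠ 0)
    (h : ∀ v : HeightOneSpectrum (𝓞 L),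
      ∃ x : v.adicCompletion L, x ^ k = algebraMap L (v.adicCompletion L) a) :
    ∃ x : L, x ^ k = a := by
  have hne : NeZero k := ⟨by rintro rfl; simp at hk⟩
  obtain ⟨b, hb⟩ := local_to_cyclo k a ha h
  obtain ⟨c, hc⟩ := conj_step (algebraMap L ℝ) k a ha b hb
  obtain ⟨j, rfl⟩ := hk
  refine ⟨a / c ^ j, ?_⟩
  rw [div_pow, ← pow_mul, mul_comm j, pow_mul, hc, ← pow_mul, pow_succ,
    mul_div_assoc, mul_comm, div_mul_cancel₀ _ (pow_ne_zero _ ha)]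

/-- Grunwald–Wang for `L = ℚ(2^{1/4})` and `S = ∅`: if `a ∈ L` is an `m`-th power in the
`p`-adic completion `L_p` for every nonzero prime ideal `p` of `O_L` (i.e. every point of the
height-one spectrum of `O_L`), then `a` is an `m`-th power in `L`. -/
theorem stmt6 (m : ℕ) (hm : 0 < m) (a : L)
    (h : ∀ v : HeightOneSpectrum (𝓞 L),
      ∃ x : v.adicCompletion L, x ^ m = algebraMap L (v.adicCompletion L) a) :
    ∃ x : L, x ^ m = a := by
  by_cases ha : a = 0
  · exact ⟨0, by rw [ha, zero_pow hm.ne']⟩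
  obtain ⟨r, k, hk, hmk⟩ := Nat.exists_eq_two_pow_mul_odd hm.ne'
  obtain ⟨y, hy⟩ : ∃ y : L, y ^ k = a := by
    refine odd_case k hk a ha fun v => ?_
    obtain ⟨x, hx⟩ := h v
    exact ⟨x ^ 2 ^ r, by rw [← pow_mul, ← hmk, hx]⟩
  obtain ⟨z, hz⟩ : ∃ z : L, z ^ 2 ^ r = a := by
    rcases r with _ | r
    · exact ⟨a, by simp⟩
    refine two_power_case r a ha fun v => ?_
    obtain ⟨x, hx⟩ := h v
    exact ⟨x ^ k, by rw [← pow_mul, mul_comm, ← hmk, hx]⟩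
  have hcop : IsCoprime ((2 ^ r : ℕ) : ℤ) (k : ℤ) := by
    rw [Nat.isCoprime_iff_coprime]
    exact Nat.Coprime.pow_left r (Nat.coprime_two_left.mpr hk)
  obtain ⟨s, t, hst⟩ := hcop
  have hy' : y ^ (k : ℤ) = a := by rw [zpow_natCast, hy]
  have hz' : z ^ ((2 ^ r : ℕ) : ℤ) = a := by rw [zpow_natCast, hz]
  refine ⟨y ^ s * z ^ t, ?_⟩
  rw [← zpow_natCast, hmk, mul_zpow, ← zpow_mul, ← zpow_mul, Nat.cast_mul,
    show s * (((2 ^ r : ℕ) : ℤ) * (k : ℤ)) = (k : ℤ) * (s * ((2 ^ r : ℕ) : ℤ)) by ring,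
    show t * (((2 ^ r : ℕ) : ℤ) * (k : ℤ)) = ((2 ^ r : ℕ) : ℤ) * (t * (k : ℤ)) by ring,
    zpow_mul y, zpow_mul z, hy', hz', ← zpow_add₀ ha, hst, zpow_one]
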